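/- Let G = (V, E) be a finite connected combinatorial graph and let v, v' ∈ V be distinct vertices. Then there exists a finite sequence (v₁, ..., vₙ) of vertices such that {v₁, ..., vₙ} = V, v₁ = v, vₙ = v', each consecutive pair {vᵢ, vᵢ₊₁} is an edge of G, and each edge e ∈ E equals {vᵢ, vᵢ₊₁} for at most two indices i. -/

import Mathlib

open List

namespace SimpleGraph.Walk

variable {V : Type*} {G : SimpleGraph V}

theorem countP_zip_support_tail [DecidableEq V] {u w : V} (p : G.Walk u w) (a b : V) :
    (p.support.zip p.support.tail).countP
      (fun q => decide ((q.1 = a ∧ q.2 = b) ∨ (q.1 = b ∧ q.2 = a))) =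
        p.edges.count s(a, b) := by
  induction p with
  | nil => simp
  | cons h p ih =>
    rw [support_cons, List.tail_cons, edges_cons, List.count_cons, ← ih]
    conv_lhs => rw [← cons_tail_support p, List.zip_cons_cons, cons_tail_support p]
    simp [List.countP_cons]

/-- A walk can be extended by a detour along a new edge and back. -/
theorem exists_detour [DecidableEq V] {u w a b : V} (p : G.Walk u w)
    (ha : a ∈ p.support) (hab : G.Adj a b) :
    ∃ q : G.Walk u w, (∀ x, x ∈ q.support ↔ x ∈ p.support ∨ x = b) ∧
      ∀ e, q.edges.count e = p.edges.count e + if s(a, b) = e then 2 else 0 := by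
  refine ⟨(p.takeUntil a ha).append (cons hab (cons hab.symm (p.dropUntil a ha))),
    fun x => ?_, fun e => ?_⟩
  · conv_rhs => rw [← p.take_spec ha]
    have hx : x = a → x ∈ (p.takeUntil a ha).support := by
      rintro rfl
      exact end_mem_support _
    simp only [mem_support_append_iff, support_cons, List.mem_cons]
    tauto
  · conv_rhs => rw [← p.take_spec ha]
    simp only [edges_append, edges_cons, List.count_append, List.count_cons,
      Sym2.eq_swap (a := b) (b := a), beq_iff_eq]
    split_ifs <;> omega

theorem exists_forall_mem_support_count_edges_le_two [Fintype V] [DecidableEq V]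
    (hG : G.Connected) {u w : V} (p : G.Walk u w) (hp : ∀ e, p.edges.count e ≤ 2) :
    ∃ q : G.Walk u w, (∀ x, x ∈ q.support) ∧ ∀ e, q.edges.count e ≤ 2 := by
  induction hn : (p.support.toFinsetᶜ).card using Nat.strong_induction_on generalizing p with
  | _ n ih =>
  by_cases hall : ∀ x, x ∈ p.support
  · exact ⟨p, hall, hp⟩
  push Not at hall
  obtain ⟨x, hx⟩ := hall
  obtain ⟨r⟩ := hG.preconnected u x
  obtain ⟨d, -, hd₁, hd₂⟩ := r.exists_boundary_dart {y | y ∈ p.support} p.start_mem_support hx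
  obtain ⟨q, hq, hcount⟩ := p.exists_detour hd₁ d.adj
  refine ih _ ?_ q (fun e => ?_) rfl
  · subst hn
    refine Finset.card_lt_card (Finset.ssubset_iff_of_subset ?_ |>.2 ⟨d.snd, ?_, ?_⟩)
    · intro y
      simp +contextual [hq]
    · simpa using hd₂
    · simp [hq]
  · rw [hcount]
    split_ifs with he
    · have : p.edges.count e = 0 :=
        List.count_eq_zero.2 fun h => hd₂ (p.snd_mem_support_of_mem_edges (he ▸ h))
      omega
    · exact hp e

end SimpleGraph.Walk

/-- in a finite connected graph, for any two distinct vertices `v ≠ v'` there is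
a walk from `v` to `v'` visiting every vertex and traversing each edge at most twice. -/
theorem statement5 {V : Type*} [Fintype V] [DecidableEq V] (G : SimpleGraph V)
    (hG : G.Connected) (v v' : V) (hvv : v ≠ v') :
    ∃ l : List V, l ≠ [] ∧ l.head? = some v ∧ l.getLast? = some v' ∧
      (∀ w : V, w ∈ l) ∧ l.Chain' G.Adj ∧
      ∀ a b : V, G.Adj a b →
        (l.zip l.tail).countP
          (fun q => decide ((q.1 = a ∧ q.2 = b) ∨ (q.1 = b ∧ q.2 = a))) ≤ 2 := by
  obtain ⟨p, hp⟩ := hG.exists_isPath v v'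
  obtain ⟨q, hq, hcount⟩ := p.exists_forall_mem_support_count_edges_le_two hG fun e =>
    (List.nodup_iff_count_le_one.1 hp.isTrail.edges_nodup e).trans one_le_two
  refine ⟨q.support, q.support_ne_nil, ?_, ?_, hq, q.isChain_adj_support, fun a b _ => ?_⟩
  · rw [List.head?_eq_some_head q.support_ne_nil, q.head_support]
  · rw [List.getLast?_eq_some_getLast q.support_ne_nil, q.getLast_support]
  · exact (q.countP_zip_support_tail a b).trans_le (hcount _)
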